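/- Let (M,η,H) be a contact Hamiltonian system and Y a dynamical similarity, i.e. [Y, X_H] = λ X_H for some λ ∈ C^∞(M), with Hamiltonian–horizontal decomposition Y = X_{φ_Y} + δ_Y (φ_Y = −η(Y), δ_Y horizontal). Then {H, φ_Y}_η = −λ H and [δ_Y, X_H] = −H X_λ − λ H R, where X_λ is the contact Hamiltonian vector field of λ and R is the Reeb vector field. -/

import Mathlib

open scoped BigOperators

/-- Vector fields on the "manifold" whose algebra of smooth functions is `R`,
modeled as ℝ-linear derivations of `R`. -/
abbrev VectorFieldOn (R : Type*) [CommRing R] [Algebra ℝ R] : Type _ := Derivation ℝ R R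

/-- The exterior derivative of a 1-form (an `R`-linear functional on vector fields),
via the intrinsic (Koszul) formula `dη(X,Y) = X(η(Y)) - Y(η(X)) - η([X,Y])`. -/
def dForm {R : Type*} [CommRing R] [Algebra ℝ R]
    (η : VectorFieldOn R →ₗ[R] R) (X Y : VectorFieldOn R) : R :=
  X (η Y) - Y (η X) - η ⁅X, Y⁆

/-- An exact contact manifold of dimension `2n+1`, described through its algebra of
smooth functions `R`: a contact form `eta`, nondegenerate and of maximal rank, with
its Reeb vector field and the contact Hamiltonian vector field assignment `ham`,
each characterized by the usual defining equations (together with uniqueness, which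
is what the contact condition `η ∧ (dη)^n ≠ 0` grants). -/
structure ExactContact (R : Type*) [CommRing R] [Algebra ℝ R] where
  n : ℕ
  eta : VectorFieldOn R →ₗ[R] R
  nondeg : ∀ Z : VectorFieldOn R, eta Z = 0 → (∀ Y, dForm eta Z Y = 0) → Z = 0
  dim_le : ∀ ω : AlternatingMap R (VectorFieldOn R) R (Fin (2 * n + 2)), ω = 0
  reeb : VectorFieldOn R
  reeb_eta : eta reeb = 1
  reeb_dEta : ∀ Y, dForm eta reeb Y = 0
  reeb_unique : ∀ Z, eta Z = 1 → (∀ Y, dForm eta Z Y = 0) → Z = reeb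
  ham : R → VectorFieldOn R
  ham_eta : ∀ f, eta (ham f) = -f
  ham_dEta : ∀ f Y, dForm eta (ham f) Y = Y f - reeb f * eta Y
  ham_unique : ∀ f Z, eta Z = -f → (∀ Y, dForm eta Z Y = Y f - reeb f * eta Y) → Z = ham f

/-- The Jacobi bracket induced by the contact form: `{f,g}_η = X_f(g) + g R(f)`. -/
def ExactContact.jacobi {R : Type*} [CommRing R] [Algebra ℝ R]
    (C : ExactContact R) (f g : R) : R :=
  C.ham f g + g * C.reeb f

theorem dForm_swap {R : Type*} [CommRing R] [Algebra ℝ R]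
    (η : VectorFieldOn R →ₗ[R] R) (X Y : VectorFieldOn R) :
    dForm η X Y = -dForm η Y X := by
  have h : η ⁅X, Y⁆ = -η ⁅Y, X⁆ := by rw [← lie_skew, map_neg]
  unfold dForm
  rw [h]
  ring

theorem dForm_add_left {R : Type*} [CommRing R] [Algebra ℝ R]
    (η : VectorFieldOn R →ₗ[R] R) (X X' Y : VectorFieldOn R) :
    dForm η (X + X') Y = dForm η X Y + dForm η X' Y := by
  simp only [dForm, add_lie, map_add, Derivation.add_apply]
  ring

theorem dForm_smul_left {R : Type*} [CommRing R] [Algebra ℝ R]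
    (η : VectorFieldOn R →ₗ[R] R) (a : R) (X Y : VectorFieldOn R) :
    dForm η (a • X) Y = a * dForm η X Y := by
  have h : ⁅a • X, Y⁆ = a • ⁅X, Y⁆ - Y a • X := by
    ext b
    simp only [Derivation.commutator_apply, Derivation.sub_apply, Derivation.smul_apply,
      smul_eq_mul, Derivation.leibniz]
    ring
  simp only [dForm, h, map_sub, map_smul, Derivation.smul_apply, smul_eq_mul,
    Derivation.leibniz]
  ring

/-- The exterior derivative of a 1-form is closed: `d(dη) = 0`. -/
theorem dForm_lie_left {R : Type*} [CommRing R] [Algebra ℝ R]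
    (η : VectorFieldOn R →ₗ[R] R) (X Y Z : VectorFieldOn R) :
    dForm η ⁅X, Y⁆ Z = X (dForm η Y Z) - Y (dForm η X Z) + Z (dForm η X Y)
      - dForm η Y ⁅X, Z⁆ + dForm η X ⁅Y, Z⁆ := by
  have h : η ⁅⁅X, Y⁆, Z⁆ = η ⁅X, ⁅Y, Z⁆⁆ - η ⁅Y, ⁅X, Z⁆⁆ := by rw [lie_lie, map_sub]
  simp only [dForm, h, map_sub, Derivation.commutator_apply]
  ring

namespace ExactContact

variable {R : Type*} [CommRing R] [Algebra ℝ R] (C : ExactContact R)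

theorem eta_lie_ham (f g : R) : C.eta ⁅C.ham f, C.ham g⁆ = -C.jacobi f g := by
  have h := C.ham_dEta f (C.ham g)
  simp only [dForm, C.ham_eta, map_neg] at h
  unfold jacobi
  linear_combination -h

theorem jacobi_swap (f g : R) : C.jacobi f g = -C.jacobi g f := by
  have h : C.eta ⁅C.ham f, C.ham g⁆ = -C.eta ⁅C.ham g, C.ham f⁆ := by
    rw [← lie_skew, map_neg]
  rw [eta_lie_ham, eta_lie_ham] at h
  linear_combination -h

/-- The contact Hamiltonian assignment intertwines the Jacobi and Lie brackets. -/
theorem lie_ham (f g : R) : ⁅C.ham f, C.ham g⁆ = C.ham (C.jacobi f g) := by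
  have key : ∀ Z, dForm C.eta ⁅C.ham f, C.ham g⁆ Z = Z (C.jacobi f g) +
      (C.ham g (C.reeb f) - C.ham f (C.reeb g)) * C.eta Z := by
    intro Z
    have hf := C.ham_dEta f Z
    have hg := C.ham_dEta g Z
    simp only [dForm, C.ham_eta, map_neg] at hf hg
    rw [dForm_lie_left]
    simp only [C.ham_dEta, C.ham_eta, jacobi, map_sub, map_add, map_neg, Derivation.leibniz,
      smul_eq_mul, Derivation.commutator_apply]
    linear_combination C.reeb f * hg - C.reeb g * hf
  have hR := key C.reeb
  rw [dForm_swap, C.reeb_dEta, C.reeb_eta] at hR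
  refine C.ham_unique _ _ (C.eta_lie_ham f g) fun Z => ?_
  rw [key]
  linear_combination -C.eta Z * hR

theorem ham_mul (f g : R) :
    C.ham (f * g) = f • C.ham g + g • C.ham f + (f * g) • C.reeb := by
  symm
  refine C.ham_unique _ _ ?_ fun Z => ?_
  · simp only [map_add, map_smul, C.ham_eta, C.reeb_eta, smul_eq_mul]
    ring
  · simp only [dForm_add_left, dForm_smul_left, C.ham_dEta, C.reeb_dEta, Derivation.leibniz,
      smul_eq_mul]
    ring

end ExactContact

/-- if `Y` is a dynamical similarity, `[Y,X_H] = λ X_H` with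
`λ ∈ C^∞(M)`, and `Y = X_{φ_Y} + δ_Y` is its Hamiltonian–horizontal decomposition,
then `{H, φ_Y}_η = -λH` and `[δ_Y, X_H] = -H X_λ - λ H R`. -/
theorem dynamical_similarity_decomposition {R : Type*} [CommRing R] [Algebra ℝ R]
    (C : ExactContact R) (H : R) (Y : VectorFieldOn R) (lam : R)
    (hY : ⁅Y, C.ham H⁆ = lam • C.ham H)
    (φ : R) (hφ : φ = -C.eta Y)
    (δ : VectorFieldOn R) (hδ : δ = Y - C.ham φ) :
    C.jacobi H φ = -(lam * H) ∧
      ⁅δ, C.ham H⁆ = -(H • C.ham lam) - (lam * H) • C.reeb := by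
  have hjac : C.jacobi H φ = -(lam * H) := by
    have h := C.ham_dEta H Y
    have hskew : C.eta ⁅C.ham H, Y⁆ = lam * H := by
      rw [← lie_skew, hY, map_neg, map_smul, C.ham_eta, smul_eq_mul]
      ring
    have hη : C.eta Y = -φ := by rw [hφ, neg_neg]
    simp only [dForm, hskew, hη, C.ham_eta, map_neg] at h
    unfold ExactContact.jacobi
    linear_combination -h
  refine ⟨hjac, ?_⟩
  rw [hδ, sub_lie, hY, C.lie_ham, C.jacobi_swap, hjac, neg_neg, C.ham_mul]
  abel
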